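/- arXiv:2105.04156 — 2 statements merged into one kernel-verified Lean document; each statement's English description precedes it below -/
import Mathlib

section
/- For every integer L ≥ 0, set h = 2^{−L}. For all integers i, j and every (x, y) ∈ [−1,1]² with i·h ≤ x ≤ (i+1)·h and j·h ≤ y ≤ (j+1)·h, the following hold: if x + y ≤ (i + j + 1)·h then m_{L+2}(x, y) = j·h·x + i·h·y − i·j·h², and if x + y ≥ (i + j + 1)·h then m_{L+2}(x, y) = (j+1)·h·x + (i+1)·h·y − (i+1)(j+1)·h². Consequently, m_{L+2} coincides on [−1,1]² with the piecewise linear interpolant Π_L m of m(x,y) = xy on the uniform criss-cross triangulation of [−1,1]² with mesh size h. -/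
/-- The hat function `g`. -/
noncomputable def hatg (x : ℝ) : ℝ :=
  if 0 ≤ x ∧ x ≤ 1/2 then 2*x
  else if 1/2 < x ∧ x ≤ 1 then 2*(1-x)
  else 0

/-- `ŝ_L(x) = |x| − Σ_{ℓ=1}^{L−1} 2^{−2ℓ} g_ℓ(|x|)`. -/
noncomputable def sHat (L : ℕ) (x : ℝ) : ℝ :=
  |x| - ∑ ℓ ∈ Finset.Icc 1 (L-1), (2:ℝ)^(-(2*(ℓ:ℤ))) * hatg^[ℓ] |x|

/-- `m_L(x,y) = 2(ŝ_L((x+y)/2) − ŝ_L(x/2) − ŝ_L(y/2))`. -/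
noncomputable def mL (L : ℕ) (x y : ℝ) : ℝ :=
  2 * (sHat L ((x + y)/2) - sHat L (x/2) - sHat L (y/2))

theorem hatg_of_le_half {z : ℝ} (h0 : 0 ≤ z) (h1 : z ≤ 1/2) : hatg z = 2 * z := by
  rw [hatg, if_pos ⟨h0, h1⟩]

theorem hatg_of_half_lt {z : ℝ} (h0 : 1/2 < z) (h1 : z ≤ 1) : hatg z = 2 * (1 - z) := by
  rw [hatg, if_neg (fun h => absurd h.2 (not_le.mpr h0)), if_pos ⟨h0, h1⟩]

/-- On nonnegative arguments, `sHat (n + 1)` is `z` minus a sum over `Finset.range n`. -/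
theorem sHat_succ_of_nonneg (n : ℕ) {z : ℝ} (hz : 0 ≤ z) :
    sHat (n + 1) z = z - ∑ l ∈ Finset.range n, (1/4 : ℝ)^(l + 1) * hatg^[l + 1] z := by
  rw [sHat, abs_of_nonneg hz, Nat.add_sub_cancel, ← Finset.Ico_add_one_right_eq_Icc,
    Finset.sum_Ico_eq_sum_range, Nat.add_sub_cancel]
  congr 1
  refine Finset.sum_congr rfl fun l _ => ?_
  rw [add_comm 1 l, zpow_neg, zpow_mul, zpow_natCast, one_div, inv_pow]
  norm_num

theorem sHat_neg (n : ℕ) (z : ℝ) : sHat n (-z) = sHat n z := by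
  simp only [sHat, abs_neg]

/-- Self-similarity of `sHat` under the hat function. -/
theorem sHat_add_two (n : ℕ) {z : ℝ} (hz : 0 ≤ z) (hg : 0 ≤ hatg z) :
    sHat (n + 2) z = z - hatg z / 2 + sHat (n + 1) (hatg z) / 4 := by
  rw [sHat_succ_of_nonneg (n + 1) hz, sHat_succ_of_nonneg n hg, Finset.sum_range_succ']
  have hsum : ∑ l ∈ Finset.range n, (1/4 : ℝ)^(l + 1 + 1) * hatg^[l + 1 + 1] z
      = (1/4) * ∑ l ∈ Finset.range n, (1/4 : ℝ)^(l + 1) * hatg^[l + 1] (hatg z) := by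
    rw [Finset.mul_sum]
    refine Finset.sum_congr rfl fun l _ => ?_
    rw [Function.iterate_succ_apply hatg (l + 1) z]
    ring
  rw [hsum]
  simp only [zero_add, pow_one, Function.iterate_one]
  ring

/-- On `[0, 1]`, `sHat (n + 1)` interpolates the square linearly on the dyadic grid. -/
theorem sHat_eq_of_mem_unit (n : ℕ) (d : ℝ) (hd : 2^n * d = 1) (k : ℤ) (z : ℝ)
    (h0 : 0 ≤ z) (h1 : z ≤ 1) (hl : k * d ≤ z) (hr : z ≤ (k + 1) * d) :
    sHat (n + 1) z = (2 * k + 1) * d * z - k * (k + 1) * d^2 := by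
  induction n generalizing d k z with
  | zero =>
    obtain rfl : d = 1 := by simpa using hd
    have hk1 : k ≤ 1 := by
      have : (k : ℝ) ≤ 1 := by linarith
      exact_mod_cast this
    have hk2 : -1 ≤ k := by
      have : (-1 : ℝ) ≤ k := by linarith
      exact_mod_cast this
    rw [sHat_succ_of_nonneg 0 h0, Finset.sum_range_zero]
    interval_cases k <;> push_cast at * <;> linarith
  | succ n ih =>
    have hd' : 2^n * (2 * d) = 1 := by rw [← hd]; ring
    rcases le_or_gt z (1/2) with hz | hz
    · have hg := hatg_of_le_half h0 hz
      rw [sHat_add_two n h0 (by linarith), hg,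
        ih (2 * d) hd' k (2 * z) (by linarith) (by linarith) (by linarith) (by linarith)]
      ring
    · have hg := hatg_of_half_lt hz h1
      have key := ih (2 * d) hd' (2^(n + 1) - k - 1) (2 * (1 - z)) (by linarith) (by linarith)
        (by push_cast; linarith) (by push_cast; linarith)
      rw [sHat_add_two n h0 (by linarith), hg, key]
      push_cast
      generalize (2 : ℝ)^(n + 1) = N at hd
      linear_combination (2 * (1 - z) - (N * d + 1) + (2 * k + 1) * d) * hd

/-- On `[-1, 1]`, `sHat (n + 1)` interpolates the square linearly on the dyadic grid. -/
theorem sHat_eq_of_mem_Icc (n : ℕ) (d : ℝ) (hd : 2^n * d = 1) (k : ℤ) (z : ℝ)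
    (h0 : -1 ≤ z) (h1 : z ≤ 1) (hl : k * d ≤ z) (hr : z ≤ (k + 1) * d) :
    sHat (n + 1) z = (2 * k + 1) * d * z - k * (k + 1) * d^2 := by
  rcases le_total 0 z with hz | hz
  · exact sHat_eq_of_mem_unit n d hd k z hz h1 hl hr
  · rw [← sHat_neg, sHat_eq_of_mem_unit n d hd (-k - 1) (-z) (by linarith) (by linarith)
      (by push_cast; linarith) (by push_cast; linarith)]
    push_cast
    ring

theorem stmt7 (L : ℕ) (h : ℝ) (hh : h = (2:ℝ)^(-(L:ℤ))) (i j : ℤ) (x y : ℝ)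
    (hx : x ∈ Set.Icc (-1:ℝ) 1) (hy : y ∈ Set.Icc (-1:ℝ) 1)
    (hxl : (i:ℝ) * h ≤ x) (hxr : x ≤ ((i:ℝ) + 1) * h)
    (hyl : (j:ℝ) * h ≤ y) (hyr : y ≤ ((j:ℝ) + 1) * h) :
    (x + y ≤ ((i:ℝ) + (j:ℝ) + 1) * h →
      mL (L+2) x y = (j:ℝ) * h * x + (i:ℝ) * h * y - (i:ℝ) * (j:ℝ) * h^2) ∧
    (((i:ℝ) + (j:ℝ) + 1) * h ≤ x + y →
      mL (L+2) x y = ((j:ℝ) + 1) * h * x + ((i:ℝ) + 1) * h * y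
        - ((i:ℝ) + 1) * ((j:ℝ) + 1) * h^2) := by
  obtain ⟨hx0, hx1⟩ := hx
  obtain ⟨hy0, hy1⟩ := hy
  have hd : (2 : ℝ)^(L + 1) * (h / 2) = 1 := by
    rw [hh, zpow_neg, zpow_natCast]
    field_simp
    ring
  have hsx := sHat_eq_of_mem_Icc (L + 1) (h / 2) hd i (x / 2) (by linarith) (by linarith)
    (by linarith) (by linarith)
  have hsy := sHat_eq_of_mem_Icc (L + 1) (h / 2) hd j (y / 2) (by linarith) (by linarith)
    (by linarith) (by linarith)
  constructor
  · intro hxy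
    have hs := sHat_eq_of_mem_Icc (L + 1) (h / 2) hd (i + j) ((x + y) / 2) (by linarith)
      (by linarith) (by push_cast; linarith) (by push_cast; linarith)
    rw [mL, hs, hsx, hsy]
    push_cast
    ring
  · intro hxy
    have hs := sHat_eq_of_mem_Icc (L + 1) (h / 2) hd (i + j + 1) ((x + y) / 2) (by linarith)
      (by linarith) (by push_cast; linarith) (by push_cast; linarith)
    rw [mL, hs, hsx, hsy]
    push_cast
    ring
end

section
/- Let M > 0 and let L ≥ 2 be an integer. Then |m_L^M(x, y) − x·y| ≤ M²·2^{−2(L−1)} for all (x, y) ∈ [−M, M]², there exists (x, y) ∈ [−M, M]² for which |m_L^M(x, y) − x·y| = M²·2^{−2(L−1)}, and moreover m_L^M(x, 0) = 0 and m_L^M(0, y) = 0 for all real x, y. -/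
/-- `m_L^M(x,y) = 2M²(ŝ_L((x+y)/(2M)) − ŝ_L(x/(2M)) − ŝ_L(y/(2M)))`. -/
noncomputable def mLM (M : ℝ) (L : ℕ) (x y : ℝ) : ℝ :=
  2 * M^2 * (sHat L ((x + y)/(2*M)) - sHat L (x/(2*M)) - sHat L (y/(2*M)))

theorem hatg_mem_Icc (x : ℝ) : hatg x ∈ Set.Icc (0:ℝ) 1 := by
  unfold hatg
  split_ifs <;> constructor <;> linarith

theorem hatg_iterate_mem_Icc {x : ℝ} (hx : x ∈ Set.Icc (0:ℝ) 1) (n : ℕ) :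
    hatg^[n] x ∈ Set.Icc (0:ℝ) 1 := by
  cases n with
  | zero => simpa using hx
  | succ n => rw [Function.iterate_succ_apply']; exact hatg_mem_Icc _

theorem sub_sq_sub_hatg {t : ℝ} (ht : t ∈ Set.Icc (0:ℝ) 1) :
    t - t^2 - hatg t / 4 = (hatg t - hatg t ^ 2) / 4 := by
  obtain ⟨h0, h1⟩ := ht
  unfold hatg
  split_ifs with h h'
  · ring
  · ring
  · rcases le_or_gt t (1/2) with h2 | h2
    · exact absurd ⟨h0, h2⟩ h
    · exact absurd ⟨h2, h1⟩ h'

theorem sub_sum_hatg_sub_sq {x : ℝ} (hx : x ∈ Set.Icc (0:ℝ) 1) (n : ℕ) :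
    x - ∑ ℓ ∈ Finset.Icc 1 n, (2:ℝ)^(-(2*(ℓ:ℤ))) * hatg^[ℓ] x - x^2
      = (2:ℝ)^(-(2*(n:ℤ))) * (hatg^[n] x - (hatg^[n] x)^2) := by
  induction n with
  | zero => simp
  | succ n ih =>
    have hp : (2:ℝ)^(-(2*((n+1:ℕ):ℤ))) = (2:ℝ)^(-(2*(n:ℤ))) / 4 := by
      rw [show -(2*((n+1:ℕ):ℤ)) = -(2*(n:ℤ)) - 2 by push_cast; ring, zpow_sub₀ two_ne_zero]
      norm_num
    have hs := sub_sq_sub_hatg (hatg_iterate_mem_Icc hx n)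
    rw [Finset.sum_Icc_succ_top (by omega), hp, Function.iterate_succ_apply']
    linear_combination ih + (2:ℝ)^(-(2*(n:ℤ))) * hs

theorem sHat_sub_sq (n : ℕ) {x : ℝ} (hx : |x| ≤ 1) :
    sHat (n+1) x - x^2
      = (2:ℝ)^(-(2*(n:ℤ))) * (hatg^[n] |x| - (hatg^[n] |x|)^2) := by
  rw [← sub_sum_hatg_sub_sq ⟨abs_nonneg x, hx⟩, sq_abs, sHat, Nat.add_sub_cancel]

theorem sHat_sub_sq_mem_Icc (n : ℕ) {x : ℝ} (hx : |x| ≤ 1) :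
    sHat (n+1) x - x^2 ∈ Set.Icc 0 ((2:ℝ)^(-(2*(n:ℤ))) / 4) := by
  obtain ⟨h0, h1⟩ := hatg_iterate_mem_Icc ⟨abs_nonneg x, hx⟩ n
  have hp : (0:ℝ) < (2:ℝ)^(-(2*(n:ℤ))) := by positivity
  rw [sHat_sub_sq n hx]
  constructor
  · exact mul_nonneg hp.le (by nlinarith)
  · rw [div_eq_mul_one_div]
    exact mul_le_mul_of_nonneg_left (by nlinarith [sq_nonneg (hatg^[n] |x| - 1/2)]) hp.le

theorem hatg_iterate_div_two_pow {t : ℝ} (ht : t ∈ Set.Icc (0:ℝ) 1) (n : ℕ) :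
    hatg^[n] (t / 2^n) = t := by
  induction n with
  | zero => simp
  | succ n ih =>
    have h0 : 0 ≤ t / 2^n := div_nonneg ht.1 (by positivity)
    have h1 : t / 2^n ≤ 1 :=
      div_le_one_of_le₀ (ht.2.trans (one_le_pow₀ one_le_two)) (by positivity)
    have h2 : t / 2^(n+1) = t / 2^n / 2 := by rw [pow_succ, div_div]
    have h3 : hatg (t / 2^n / 2) = t / 2^n := by
      rw [hatg, if_pos ⟨by linarith, by linarith⟩]
      ring
    rw [Function.iterate_succ_apply, h2, h3, ih]

theorem hatg_zero : hatg 0 = 0 := by norm_num [hatg]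

theorem sHat_zero (L : ℕ) : sHat L 0 = 0 := by
  simp [sHat, Function.iterate_fixed hatg_zero]

theorem mLM_sub_mul {M : ℝ} (hM : M ≠ 0) (L : ℕ) (x y : ℝ) :
    mLM M L x y - x * y = 2 * M^2 * ((sHat L ((x + y)/(2*M)) - ((x + y)/(2*M))^2)
      - (sHat L (x/(2*M)) - (x/(2*M))^2) - (sHat L (y/(2*M)) - (y/(2*M))^2)) := by
  unfold mLM
  field_simp
  ring

theorem stmt10 (M : ℝ) (hM : 0 < M) (L : ℕ) (hL : 2 ≤ L) :
    (∀ x ∈ Set.Icc (-M) M, ∀ y ∈ Set.Icc (-M) M,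
      |mLM M L x y - x * y| ≤ M^2 * (2:ℝ)^(-(2*((L:ℤ)-1)))) ∧
    (∃ x ∈ Set.Icc (-M) M, ∃ y ∈ Set.Icc (-M) M,
      |mLM M L x y - x * y| = M^2 * (2:ℝ)^(-(2*((L:ℤ)-1)))) ∧
    (∀ x : ℝ, mLM M L x 0 = 0) ∧ (∀ y : ℝ, mLM M L 0 y = 0) := by
  obtain ⟨n, rfl⟩ : ∃ n, L = n + 1 := ⟨L - 1, by omega⟩
  rw [show ((n + 1 : ℕ) : ℤ) - 1 = n by push_cast; ring]
  refine ⟨?_, ?_, fun x => by simp [mLM, sHat_zero], fun y => by simp [mLM, sHat_zero]⟩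
  · rintro x ⟨hx0, hx1⟩ y ⟨hy0, hy1⟩
    have key : ∀ z : ℝ, -(2*M) ≤ z → z ≤ 2*M → |z / (2*M)| ≤ 1 := fun z h0 h1 => by
      rw [abs_div, abs_of_pos (by positivity : 0 < 2*M)]
      exact div_le_one_of_le₀ (abs_le.2 ⟨h0, h1⟩) (by positivity)
    obtain ⟨a0, a1⟩ := sHat_sub_sq_mem_Icc n (key (x + y) (by linarith) (by linarith))
    obtain ⟨b0, b1⟩ := sHat_sub_sq_mem_Icc n (key x (by linarith) (by linarith))
    obtain ⟨c0, c1⟩ := sHat_sub_sq_mem_Icc n (key y (by linarith) (by linarith))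
    have hM2 : 0 < 2 * M^2 := by positivity
    have hp : (0:ℝ) < (2:ℝ)^(-(2*(n:ℤ))) := by positivity
    rw [mLM_sub_mul hM.ne', abs_mul, abs_of_pos hM2,
      show M^2 * (2:ℝ)^(-(2*(n:ℤ))) = 2 * M^2 * ((2:ℝ)^(-(2*(n:ℤ))) / 2) by ring]
    refine mul_le_mul_of_nonneg_left (abs_le.2 ⟨?_, ?_⟩) hM2.le <;> linarith
  · have hpow : (1:ℝ) ≤ 2^n := one_le_pow₀ one_le_two
    have hmem : M / 2^n ∈ Set.Icc (-M) M := by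
      have h0 : 0 ≤ M / 2^n := by positivity
      exact ⟨by linarith, div_le_self hM.le hpow⟩
    refine ⟨M / 2^n, hmem, M / 2^n, hmem, ?_⟩
    have err : ∀ t ∈ Set.Icc (0:ℝ) 1, sHat (n+1) (t / 2^n) - (t / 2^n)^2
        = (2:ℝ)^(-(2*(n:ℤ))) * (t - t^2) := fun t ht => by
      have h0 : 0 ≤ t / 2^n := div_nonneg ht.1 (by positivity)
      have h1 : |t / 2^n| ≤ 1 := by
        rw [abs_of_nonneg h0]
        exact div_le_one_of_le₀ (ht.2.trans hpow) (by positivity)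
      rw [sHat_sub_sq n h1, abs_of_nonneg h0, hatg_iterate_div_two_pow ht]
    have hp : (0:ℝ) < (2:ℝ)^(-(2*(n:ℤ))) := by positivity
    rw [mLM_sub_mul hM.ne',
      show (M / 2^n + M / 2^n) / (2*M) = 1 / 2^n by field_simp; norm_num,
      show M / 2^n / (2*M) = (1/2) / 2^n by field_simp,
      err 1 (by norm_num), err (1/2) (by norm_num),
      show 2 * M^2 * ((2:ℝ)^(-(2*(n:ℤ))) * (1 - 1^2) - (2:ℝ)^(-(2*(n:ℤ))) * (1/2 - (1/2)^2)
        - (2:ℝ)^(-(2*(n:ℤ))) * (1/2 - (1/2)^2)) = -(M^2 * (2:ℝ)^(-(2*(n:ℤ)))) by ring,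
      abs_neg, abs_of_pos (by positivity)]
end
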